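/- Let M be a g×g complex symmetric matrix with positive definite imaginary part, and let γ = [[A,B],[C,D]] ∈ Sp(2g,ℝ). Then CM + D is invertible and γ·M = (AM+B)(CM+D)⁻¹ also has positive definite imaginary part. Hence Sp(2g,ℝ) acts on the Siegel upper half-space ℍ_g. -/

import Mathlib

open Matrix

/-- The standard symplectic form `J = [[0, I], [-I, 0]]` over ℝ. -/
def symplJR (g : ℕ) : Matrix (Fin g ⊕ Fin g) (Fin g ⊕ Fin g) ℝ :=
  Matrix.fromBlocks 0 1 (-1) 0

/-- The entrywise imaginary part of a complex matrix. -/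
def imPart {g : ℕ} (M : Matrix (Fin g) (Fin g) ℂ) : Matrix (Fin g) (Fin g) ℝ :=
  Matrix.of fun i j => (M i j).im

theorem symplJR_mul_self (g : ℕ) : symplJR g * symplJR g = -1 := by
  simp [symplJR, fromBlocks_multiply, ← fromBlocks_one, fromBlocks_neg]

/-- The transpose of a symplectic matrix is symplectic. -/
theorem transpose_mul_symplJR_mul {g : ℕ} {Γ : Matrix (Fin g ⊕ Fin g) (Fin g ⊕ Fin g) ℝ}
    (h : Γ * symplJR g * Γᵀ = symplJR g) : Γᵀ * symplJR g * Γ = symplJR g := by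
  have hinv : Γ * -(symplJR g * Γᵀ * symplJR g) = 1 := by
    rw [Matrix.mul_neg, ← Matrix.mul_assoc, ← Matrix.mul_assoc, h, symplJR_mul_self, neg_neg]
  have hinv' := mul_eq_one_comm.mp hinv
  calc Γᵀ * symplJR g * Γ
      = symplJR g * (-(symplJR g * Γᵀ * symplJR g) * Γ) := by
        simp only [Matrix.neg_mul, Matrix.mul_neg, ← Matrix.mul_assoc, symplJR_mul_self,
          Matrix.one_mul, neg_neg]
    _ = symplJR g := by rw [hinv', Matrix.mul_one]

/-- The relations between the blocks of a symplectic matrix. -/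
theorem symplectic_block_relations {g : ℕ} {A B C D : Matrix (Fin g) (Fin g) ℝ}
    (h : fromBlocks A B C D * symplJR g * (fromBlocks A B C D)ᵀ = symplJR g) :
    Aᵀ * C = Cᵀ * A ∧ Aᵀ * D = 1 + Cᵀ * B ∧ Bᵀ * C = Dᵀ * A - 1 ∧ Bᵀ * D = Dᵀ * B := by
  have h' := transpose_mul_symplJR_mul h
  simp only [symplJR, fromBlocks_transpose, fromBlocks_multiply, fromBlocks_inj, Matrix.mul_zero,
    Matrix.mul_one, Matrix.mul_neg, zero_add, add_zero, Matrix.neg_mul] at h'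
  obtain ⟨h₁, h₂, h₃, h₄⟩ := h'
  refine ⟨?_, ?_, ?_, ?_⟩
  · rw [← sub_eq_zero, ← h₁]; abel
  · rw [← h₂]; abel
  · rw [sub_eq_add_neg, ← h₃]; abel
  · rw [← sub_eq_zero, ← h₄]; abel

/-- The symplectic form evaluated on the graphs of `N` and `M` is preserved by `γ`. -/
theorem transpose_mul_sub_transpose_mul {g : ℕ} {A B C D : Matrix (Fin g) (Fin g) ℝ}
    (h : fromBlocks A B C D * symplJR g * (fromBlocks A B C D)ᵀ = symplJR g)
    (N M : Matrix (Fin g) (Fin g) ℂ) :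
    (A.map Complex.ofReal * N + B.map Complex.ofReal)ᵀ *
        (C.map Complex.ofReal * M + D.map Complex.ofReal) -
      (C.map Complex.ofReal * N + D.map Complex.ofReal)ᵀ *
        (A.map Complex.ofReal * M + B.map Complex.ofReal) = Nᵀ - M := by
  obtain ⟨h₁, h₂, h₃, h₄⟩ := symplectic_block_relations h
  replace h₁ := congrArg Complex.ofRealHom.mapMatrix h₁
  replace h₂ := congrArg Complex.ofRealHom.mapMatrix h₂
  replace h₃ := congrArg Complex.ofRealHom.mapMatrix h₃
  replace h₄ := congrArg Complex.ofRealHom.mapMatrix h₄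
  simp only [map_mul, map_add, map_sub, map_one, RingHom.mapMatrix_apply,
    transpose_map] at h₁ h₂ h₃ h₄
  simp only [transpose_add, transpose_mul]
  generalize A.map Complex.ofReal = a at *
  generalize B.map Complex.ofReal = b at *
  generalize C.map Complex.ofReal = c at *
  generalize D.map Complex.ofReal = d at *
  calc _ = Nᵀ * (aᵀ * c) * M + Nᵀ * (aᵀ * d) + (bᵀ * c) * M + bᵀ * d
        - (Nᵀ * (cᵀ * a) * M + Nᵀ * (cᵀ * b) + (dᵀ * a) * M + dᵀ * b) := by noncomm_ring
    _ = _ := by rw [h₁, h₂, h₃, h₄]; noncomm_ring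

open scoped ComplexOrder MatrixOrder Matrix.Norms.L2Operator in
/-- A real matrix is positive definite iff it is so as a complex matrix. -/
theorem posDef_map_ofReal_iff {n : Type*} [Fintype n] {Y : Matrix n n ℝ} :
    (Y.map Complex.ofReal).PosDef ↔ Y.PosDef := by
  classical
  constructor
  · intro h
    refine .of_dotProduct_mulVec_pos ?_ fun x hx => ?_
    · ext i j
      simpa using h.1.apply i j
    · have hx' : (Complex.ofReal ∘ x) ≠ 0 := fun h0 => hx <| by
        ext i
        simpa using congrFun h0 i
      have hpos := h.dotProduct_mulVec_pos hx'
      have hcast : star (Complex.ofReal ∘ x) ⬝ᵥ (Y.map Complex.ofReal *ᵥ (Complex.ofReal ∘ x)) =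
          ((star x ⬝ᵥ (Y *ᵥ x) : ℝ) : ℂ) := by
        simp [dotProduct, mulVec]
      rw [hcast] at hpos
      exact_mod_cast hpos
  · intro h
    obtain ⟨S, rfl⟩ := CStarAlgebra.nonneg_iff_eq_star_mul_self.mp h.posSemidef.nonneg
    have hmap : (star S * S).map Complex.ofReal =
        (S.map Complex.ofReal)ᴴ * S.map Complex.ofReal := by
      ext i j
      simp [mul_apply, star_eq_conjTranspose]
    have hS : IsUnit S := isUnit_of_mul_isUnit_right h.isUnit
    rw [hmap]
    refine .conjTranspose_mul_self _ (mulVec_injective_iff_isUnit.mpr ?_)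
    exact hS.map Complex.ofRealHom.mapMatrix

theorem conjTranspose_sub_self_of_isSymm {g : ℕ} {M : Matrix (Fin g) (Fin g) ℂ} (hM : Mᵀ = M) :
    Mᴴ - M = (-2 * Complex.I) • (imPart M).map Complex.ofReal := by
  ext i j
  have hij : M j i = M i j := congrFun (congrFun hM i) j
  apply Complex.ext <;> simp [imPart, hij]
  ring

open scoped ComplexOrder in
theorem isUnit_and_posDef_imPart {g : ℕ} {M P Q : Matrix (Fin g) (Fin g) ℂ}
    (hIm : (imPart M).PosDef) (hsymm : Qᵀ * P = Pᵀ * Q)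
    (hherm : Qᴴ * P - Pᴴ * Q = (-2 * Complex.I) • (imPart M).map Complex.ofReal) :
    IsUnit P ∧ (imPart (Q * P⁻¹)).PosDef := by
  have hY := posDef_map_ofReal_iff.mpr hIm
  have hI : (-2 * Complex.I) ≠ 0 := by simp
  have hP : IsUnit P := by
    rw [isUnit_iff_isUnit_det, isUnit_iff_ne_zero]
    intro hdet
    obtain ⟨v, hv, hPv⟩ := exists_mulVec_eq_zero_iff.mpr hdet
    have hzero : star v ⬝ᵥ ((Qᴴ * P - Pᴴ * Q) *ᵥ v) = 0 := by
      rw [sub_mulVec, ← mulVec_mulVec, ← mulVec_mulVec, hPv, mulVec_zero, zero_sub,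
        dotProduct_neg, dotProduct_mulVec, ← star_mulVec, hPv, star_zero, zero_dotProduct, neg_zero]
    rw [hherm, smul_mulVec, dotProduct_smul, smul_eq_mul] at hzero
    exact (hY.dotProduct_mulVec_pos hv).ne' ((mul_eq_zero.mp hzero).resolve_left hI)
  refine ⟨hP, ?_⟩
  have hdet : IsUnit P.det := (isUnit_iff_isUnit_det P).mp hP
  have hPP : P * P⁻¹ = 1 := mul_nonsing_inv P hdet
  have hZ : (Q * P⁻¹)ᵀ = Q * P⁻¹ := by
    have hPT : (P⁻¹)ᵀ * Pᵀ = 1 := by rw [← transpose_mul, hPP, transpose_one]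
    calc (Q * P⁻¹)ᵀ = (P⁻¹)ᵀ * (Qᵀ * P) * P⁻¹ := by
          rw [transpose_mul, Matrix.mul_assoc, Matrix.mul_assoc, hPP, Matrix.mul_one]
      _ = (P⁻¹)ᵀ * Pᵀ * (Q * P⁻¹) := by rw [hsymm]; simp only [Matrix.mul_assoc]
      _ = Q * P⁻¹ := by rw [hPT, Matrix.one_mul]
  have hPH : (P⁻¹)ᴴ * Pᴴ = 1 := by rw [← conjTranspose_mul, hPP, conjTranspose_one]
  have hconj : (Q * P⁻¹)ᴴ - Q * P⁻¹ = (P⁻¹)ᴴ * (Qᴴ * P - Pᴴ * Q) * P⁻¹ := by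
    calc (Q * P⁻¹)ᴴ - Q * P⁻¹
        = (P⁻¹)ᴴ * Qᴴ * (P * P⁻¹) - (P⁻¹)ᴴ * Pᴴ * (Q * P⁻¹) := by
          rw [hPP, hPH, conjTranspose_mul, Matrix.mul_one, Matrix.one_mul]
      _ = _ := by simp only [Matrix.mul_sub, Matrix.sub_mul, Matrix.mul_assoc]
  rw [conjTranspose_sub_self_of_isSymm hZ, hherm, Matrix.mul_smul, Matrix.smul_mul] at hconj
  rw [← posDef_map_ofReal_iff, smul_right_injective _ hI hconj]
  exact hY.conjTranspose_mul_mul_same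
    (mulVec_injective_iff_isUnit.mpr (isUnit_nonsing_inv_iff.mpr hP))

/-- If `M` is in the Siegel upper half-space (symmetric, `Im M` positive definite) and
`γ = [[A,B],[C,D]] ∈ Sp(2g,ℝ)`, then `CM+D` is invertible and `γ·M = (AM+B)(CM+D)⁻¹`
again has positive definite imaginary part. -/
theorem stmt14 (g : ℕ)
    (M : Matrix (Fin g) (Fin g) ℂ) (hM : Mᵀ = M) (hIm : (imPart M).PosDef)
    (A B C D : Matrix (Fin g) (Fin g) ℝ)
    (hSp : Matrix.fromBlocks A B C D * symplJR g * (Matrix.fromBlocks A B C D)ᵀ = symplJR g) :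
    IsUnit (C.map Complex.ofReal * M + D.map Complex.ofReal) ∧
    (imPart ((A.map Complex.ofReal * M + B.map Complex.ofReal) *
        (C.map Complex.ofReal * M + D.map Complex.ofReal)⁻¹)).PosDef := by
  have hsymm := transpose_mul_sub_transpose_mul hSp M M
  have hherm := transpose_mul_sub_transpose_mul hSp (M.map star) M
  have hct (X Y : Matrix (Fin g) (Fin g) ℝ) :
      (X.map Complex.ofReal * M.map star + Y.map Complex.ofReal)ᵀ =
        (X.map Complex.ofReal * M + Y.map Complex.ofReal)ᴴ := by
    ext i j
    simp [mul_apply]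
  rw [hM, sub_self, sub_eq_zero] at hsymm
  rw [hct, hct] at hherm
  exact isUnit_and_posDef_imPart hIm hsymm (hherm.trans (conjTranspose_sub_self_of_isSymm hM))
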